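/- Let f ∈ C⁰(ℝ) (with f ∈ C¹ where stability is evaluated) and suppose that u = 0 is the only bounded stable C² solution of −Δu = f(u) in ℝ^N. If u ∈ C²(ℝ^N) is a bounded solution of −Δu = f(u) which is stable outside a compact set, then u(x) → 0 as |x| → ∞. -/

import Mathlib

open MeasureTheory Filter Topology
open scoped ENNReal

/-- The Laplacian of `u : ℝ^N → ℝ`. -/
noncomputable def lap {N : ℕ} (u : EuclideanSpace ℝ (Fin N) → ℝ)
    (x : EuclideanSpace ℝ (Fin N)) : ℝ :=
  ∑ i : Fin N, iteratedFDeriv ℝ 2 u x ![EuclideanSpace.single i 1, EuclideanSpace.single i 1]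

/-- `u` is a stable solution w.r.t. the linearized weight `g = f'`:
`∫ f'(u) φ² ≤ ∫ |∇φ|²` for all `φ ∈ C¹_c(ℝ^N)`. -/
def Stable {N : ℕ} (g : ℝ → ℝ) (u : EuclideanSpace ℝ (Fin N) → ℝ) : Prop :=
  ∀ φ : EuclideanSpace ℝ (Fin N) → ℝ, ContDiff ℝ 1 φ → HasCompactSupport φ →
    ∫ x, g (u x) * (φ x) ^ 2 ≤ ∫ x, ‖gradient φ x‖ ^ 2

/-- `u` is stable outside the set `K` : the stability inequality holds for all
`φ ∈ C¹_c(ℝ^N \ K)`. -/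
def StableOutside {N : ℕ} (g : ℝ → ℝ) (u : EuclideanSpace ℝ (Fin N) → ℝ)
    (K : Set (EuclideanSpace ℝ (Fin N))) : Prop :=
  ∀ φ : EuclideanSpace ℝ (Fin N) → ℝ, ContDiff ℝ 1 φ → HasCompactSupport φ →
    tsupport φ ⊆ Kᶜ →
    ∫ x, g (u x) * (φ x) ^ 2 ≤ ∫ x, ‖gradient φ x‖ ^ 2

/-- The quantity `q(u) = f'(u)²/(f(u) f''(u)) ∈ [0,∞]`, with the convention
`q(u) = +∞` when `f(u) f''(u) = 0`. -/
noncomputable def qfun (f : ℝ → ℝ) (t : ℝ) : ℝ≥0∞ :=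
  if f t * deriv (deriv f) t = 0 then ⊤
  else ENNReal.ofReal ((deriv f t) ^ 2 / (f t * deriv (deriv f) t))

/-- The Joseph–Lundgren exponent `p_c(N)` (for `N ≥ 11`). -/
noncomputable def pc (N : ℕ) : ℝ :=
  (((N : ℝ) - 2) ^ 2 - 4 * N + 8 * Real.sqrt ((N : ℝ) - 1)) / (((N : ℝ) - 2) * ((N : ℝ) - 10))

/-- The necessary second-derivative condition at a local maximum. -/
theorem IsLocalMax.second_deriv_nonpos {g g' : ℝ → ℝ} {c a : ℝ} (hmax : IsLocalMax g a)
    (hg : ∀ t, HasDerivAt g (g' t) t) (hg' : HasDerivAt g' c a) : c ≤ 0 := by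
  by_contra! hc
  have hd : deriv g = g' := funext fun t => (hg t).deriv
  have hmin : IsLocalMin g a := by
    refine isLocalMin_of_deriv_deriv_pos ?_ hmax.deriv_eq_zero (hg a).continuousAt
    rw [hd, hg'.deriv]
    exact hc
  have hconst : g =ᶠ[𝓝 a] fun _ => g a := by
    filter_upwards [hmax, hmin] with x h1 h2 using le_antisymm h1 h2
  have hzero : g' =ᶠ[𝓝 a] fun _ => 0 := by
    simpa [hd] using hconst.deriv
  have := hzero.deriv_eq
  rw [hg'.deriv, deriv_const] at this
  exact hc.ne' this

theorem lap_eq_sum_fderiv {N : ℕ} (u : EuclideanSpace ℝ (Fin N) → ℝ)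
    (x : EuclideanSpace ℝ (Fin N)) :
    lap u x = ∑ i : Fin N, fderiv ℝ (fderiv ℝ u) x (EuclideanSpace.single i 1)
      (EuclideanSpace.single i 1) := by
  simp [lap, iteratedFDeriv_two_apply]

theorem ContDiff.differentiable_fderiv_of_two {E F : Type*} [NormedAddCommGroup E]
    [NormedSpace ℝ E] [NormedAddCommGroup F] [NormedSpace ℝ F] {w : E → F}
    (hw : ContDiff ℝ 2 w) : Differentiable ℝ (fderiv ℝ w) :=
  (hw.fderiv_right (m := 1) (by norm_num)).differentiable (by norm_num)

theorem hasDerivAt_comp_line {E F : Type*} [NormedAddCommGroup E] [NormedSpace ℝ E]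
    [NormedAddCommGroup F] [NormedSpace ℝ F] {w : E → F} (hw : Differentiable ℝ w) (x e : E)
    (t : ℝ) : HasDerivAt (fun s : ℝ => w (x + s • e)) (fderiv ℝ w (x + t • e) e) t := by
  have h : HasDerivAt (fun s : ℝ => x + s • e) e t := by
    simpa using ((hasDerivAt_id t).smul_const e).const_add x
  exact (hw _).hasFDerivAt.comp_hasDerivAt t h

theorem hasDerivAt_fderiv_comp_line {E F : Type*} [NormedAddCommGroup E] [NormedSpace ℝ E]
    [NormedAddCommGroup F] [NormedSpace ℝ F] {w : E → F} (hw : ContDiff ℝ 2 w) (x e : E)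
    (t : ℝ) : HasDerivAt (fun s : ℝ => fderiv ℝ w (x + s • e) e)
      (fderiv ℝ (fderiv ℝ w) (x + t • e) e e) t := by
  have h := (hasDerivAt_comp_line hw.differentiable_fderiv_of_two x e t).clm_apply
    (hasDerivAt_const t e)
  simpa using h

/-- Comparison of the odd part of `w` in the `i`-th variable with a quadratic barrier in a slab. -/
theorem odd_part_le_barrier {N : ℕ} (i : Fin N) {w : EuclideanSpace ℝ (Fin N) → ℝ}
    (hw : ContDiff ℝ 2 w) {M A d t : ℝ} (hA : 0 < A) (hM : ∀ x, |w x| ≤ M)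
    (hlap : ∀ x, |lap w x| ≤ A) (ht : 0 < t) (htd : t < d) :
    (w (t • EuclideanSpace.single i 1) - w (-(t • EuclideanSpace.single i 1))) / 2
      ≤ t * (M / d + 2 * A * d) := by
  have hd : 0 < d := ht.trans htd
  have hN : (1 : ℝ) ≤ N := by exact_mod_cast (Nat.succ_le_of_lt (Nat.pos_of_ne_zero
    (fun h => by subst h; exact i.elim0)))
  have hM0 : 0 ≤ M := (abs_nonneg _).trans (hM 0)
  let e : Fin N → EuclideanSpace ℝ (Fin N) := fun j => EuclideanSpace.single j 1
  obtain ⟨δ, hδ⟩ : ∃ δ, δ = A / (2 * N) := ⟨_, rfl⟩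
  have hδ0 : 0 < δ := by rw [hδ]; positivity
  have hδN : 2 * N * δ = A := by rw [hδ]; field_simp
  have hδA : δ ≤ A / 2 := by nlinarith
  obtain ⟨ρ, hρ⟩ : ∃ ρ, ρ = M / δ + 1 + d := ⟨_, rfl⟩
  have hρ1 : 1 ≤ ρ := by
    rw [hρ]
    have : 0 ≤ M / δ := by positivity
    linarith
  have hρd : d ≤ ρ := by
    rw [hρ]
    have : 0 ≤ M / δ := by positivity
    linarith
  have hρM : M ≤ δ * ρ ^ 2 := by
    have h1 : M ≤ δ * ρ := by
      have : δ * (M / δ) = M := by field_simp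
      rw [hρ]; nlinarith
    nlinarith [mul_le_mul_of_nonneg_left hρ1 (mul_pos hδ0 (by linarith : 0 < ρ)).le]
  let R : EuclideanSpace ℝ (Fin N) → EuclideanSpace ℝ (Fin N) := fun x => x - (2 * x i) • e i
  let F : EuclideanSpace ℝ (Fin N) → ℝ := fun x =>
    (w x - w (R x)) / 2 - M / d * x i - 3 * A / 2 * (x i * (d - x i)) - δ * ‖x‖ ^ 2
  have hcoord : Continuous fun x : EuclideanSpace ℝ (Fin N) => x i :=
    (EuclideanSpace.proj i : EuclideanSpace ℝ (Fin N) →L[ℝ] ℝ).continuous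
  have hRc : Continuous R := by
    exact continuous_id.sub ((continuous_const.mul hcoord).smul continuous_const)
  have hFc : Continuous F := by
    have := hw.continuous
    have h2 := hw.continuous.comp hRc
    simp only [Function.comp_def] at h2
    exact ((((this.sub h2).div_const 2).sub (continuous_const.mul hcoord)).sub
      (continuous_const.mul (hcoord.mul (continuous_const.sub hcoord)))).sub
      (continuous_const.mul (continuous_norm.pow 2))
  let S : Set (EuclideanSpace ℝ (Fin N)) :=
    {x | 0 ≤ x i ∧ x i ≤ d} ∩ Metric.closedBall 0 ρ
  have hS : IsCompact S :=
    (isCompact_closedBall 0 ρ).inter_left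
      ((isClosed_le continuous_const hcoord).inter (isClosed_le hcoord continuous_const))
  have hFle : ∀ x, F x ≤ M - M / d * x i - 3 * A / 2 * (x i * (d - x i)) - δ * ‖x‖ ^ 2 := by
    intro x
    have h1 := abs_le.1 (hM x)
    have h2 := abs_le.1 (hM (R x))
    simp only [F]
    linarith
  have hei : ‖e i‖ = 1 := by simp [e]
  have heii : e i i = 1 := by simp [e]
  have htS : t • e i ∈ S := by
    refine ⟨⟨?_, ?_⟩, ?_⟩
    · simp [heii, ht.le]
    · simp [heii, htd.le]
    · rw [mem_closedBall_zero_iff, norm_smul, hei, Real.norm_eq_abs, abs_of_pos ht]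
      linarith
  obtain ⟨x₀, hx₀S, hx₀⟩ := hS.exists_isMaxOn ⟨_, htS⟩ hFc.continuousOn
  have hx₀le : F x₀ ≤ 0 := by
    by_contra! hpos
    obtain ⟨⟨h0, h1⟩, hball⟩ := hx₀S
    rw [mem_closedBall_zero_iff] at hball
    have h0' : 0 < x₀ i := by
      refine lt_of_le_of_ne h0 fun h => ?_
      have : F x₀ = - (δ * ‖x₀‖ ^ 2) := by simp [F, R, ← h]
      have : 0 ≤ δ * ‖x₀‖ ^ 2 := by positivity
      linarith
    have h1' : x₀ i < d := by
      refine lt_of_le_of_ne h1 fun h => ?_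
      have h2 := hFle x₀
      rw [h, div_mul_cancel₀ _ hd.ne'] at h2
      have : 0 ≤ δ * ‖x₀‖ ^ 2 := by positivity
      linarith
    have hball' : ‖x₀‖ < ρ := by
      refine lt_of_le_of_ne hball fun h => ?_
      have h2 := hFle x₀
      rw [h] at h2
      have h3 : 0 ≤ M / d * x₀ i := by positivity
      have h4 : 0 ≤ 3 * A / 2 * (x₀ i * (d - x₀ i)) :=
        mul_nonneg (by positivity) (mul_nonneg h0 (by linarith))
      linarith
    have hSn : S ∈ 𝓝 x₀ := by
      refine inter_mem ?_ ?_
      · filter_upwards [hcoord.continuousAt.eventually (lt_mem_nhds h0'),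
          hcoord.continuousAt.eventually (gt_mem_nhds h1')] with x ha hb using ⟨ha.le, hb.le⟩
      · exact Metric.closedBall_mem_nhds_of_mem (by simpa using hball')
    have hloc : IsLocalMax F x₀ := hx₀.isLocalMax hSn
    let c : Fin N → ℝ := fun j =>
      (fderiv ℝ (fderiv ℝ w) x₀ (e j) (e j) - fderiv ℝ (fderiv ℝ w) (R x₀) (e j) (e j)) / 2
        + 3 * A * (if j = i then 1 else 0) - 2 * δ
    have hc : ∀ j, c j ≤ 0 := by
      intro j
      obtain ⟨s, hs⟩ : ∃ s : ℝ, s = if j = i then 1 else 0 := ⟨_, rfl⟩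
      have hss : s * s = s := by rw [hs]; split_ifs <;> simp
      have hej : ∀ r : ℝ, (x₀ + r • e j) i = x₀ i + r * s := by
        intro r
        simp only [e, hs, PiLp.add_apply, PiLp.smul_apply, smul_eq_mul]
        by_cases hji : j = i
        · subst hji; simp
        · simp [hji, Ne.symm hji]
      have hs_ei : s • e i = s • e j := by
        rw [hs]; split_ifs with h
        · rw [h]
        · simp
      have hRej : ∀ r : ℝ, R (x₀ + r • e j) = R x₀ + r • ((1 - 2 * s) • e j) := by
        intro r
        simp only [R]
        rw [hej]
        have : (2 * (x₀ i + r * s)) • e i = (2 * x₀ i) • e i + (2 * r) • (s • e i) := by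
          module
        rw [this, hs_ei]
        module
      have hnorm : ∀ r : ℝ, ‖x₀ + r • e j‖ ^ 2 = ‖x₀‖ ^ 2 + 2 * r * inner ℝ x₀ (e j) + r ^ 2 := by
        intro r
        rw [norm_add_sq_real, norm_smul, inner_smul_right]
        simp [e]
        ring
      have hline : ∀ r : ℝ, F (x₀ + r • e j) =
          (w (x₀ + r • e j) - w (R x₀ + r • ((1 - 2 * s) • e j))) / 2 - M / d * (x₀ i + r * s)
            - 3 * A / 2 * ((x₀ i + r * s) * (d - (x₀ i + r * s)))
            - δ * (‖x₀‖ ^ 2 + 2 * r * inner ℝ x₀ (e j) + r ^ 2) := by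
        intro r
        simp only [F]
        rw [hRej, hej, hnorm]
      have hmax : IsLocalMax (fun r : ℝ => F (x₀ + r • e j)) 0 := by
        have hcont : ContinuousAt (fun r : ℝ => x₀ + r • e j) 0 := by fun_prop
        have : Tendsto (fun r : ℝ => x₀ + r • e j) (𝓝 0) (𝓝 x₀) := by
          simpa [ContinuousAt] using hcont
        have := this.eventually hloc
        simpa [IsLocalMax, IsMaxFilter] using this
      simp only [hline] at hmax
      have hw1 : Differentiable ℝ w := hw.differentiable (by norm_num)
      have hlin : ∀ r : ℝ, HasDerivAt (fun r : ℝ => x₀ i + r * s) s r := by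
        intro r
        simpa using ((hasDerivAt_id r).mul_const s).const_add (x₀ i)
      have key := hmax.second_deriv_nonpos
        (g' := fun r => (fderiv ℝ w (x₀ + r • e j) (e j)
            - fderiv ℝ w (R x₀ + r • ((1 - 2 * s) • e j)) ((1 - 2 * s) • e j)) / 2 - M / d * s
            - 3 * A / 2 * (s * (d - (x₀ i + r * s)) + (x₀ i + r * s) * (-s))
            - δ * (2 * inner ℝ x₀ (e j) + 2 * r))
        (c := (fderiv ℝ (fderiv ℝ w) (x₀ + (0 : ℝ) • e j) (e j) (e j)
            - fderiv ℝ (fderiv ℝ w) (R x₀ + (0 : ℝ) • ((1 - 2 * s) • e j)) ((1 - 2 * s) • e j)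
              ((1 - 2 * s) • e j)) / 2
            - 3 * A / 2 * (s * (-s) + s * (-s)) - δ * 2)
        (fun r => by
          refine (((((hasDerivAt_comp_line hw1 x₀ (e j) r).sub
            (hasDerivAt_comp_line hw1 (R x₀) _ r)).div_const 2).sub
            ((hlin r).const_mul _)).sub
            (((hlin r).mul ((hlin r).const_sub d)).const_mul _)).sub (HasDerivAt.const_mul _ ?_)
          have h1 : HasDerivAt (fun r : ℝ => ‖x₀‖ ^ 2 + 2 * r * inner ℝ x₀ (e j) + r ^ 2)
            (2 * 1 * inner ℝ x₀ (e j) + 2 * r ^ (2 - 1) * 1) r :=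
            ((((hasDerivAt_id r).const_mul 2).mul_const _).const_add _).add
              ((hasDerivAt_id r).pow 2)
          simpa using h1)
        (by
          have h2 : HasDerivAt (fun r : ℝ => 2 * inner ℝ x₀ (e j) + 2 * r) 2 0 := by
            simpa using ((hasDerivAt_id (0 : ℝ)).const_mul 2).const_add (2 * inner ℝ x₀ (e j))
          refine (((((hasDerivAt_fderiv_comp_line hw x₀ (e j) 0).sub
            (hasDerivAt_fderiv_comp_line hw (R x₀) _ 0)).div_const 2).sub_const _).sub
            (((((hlin 0).const_sub d).const_mul s).add ((hlin 0).mul_const (-s))).const_mul _)).sub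
            (h2.const_mul _))
      simp only [zero_smul, add_zero, map_smul, smul_apply, smul_eq_mul] at key
      have hs2 : (1 - 2 * s) * ((1 - 2 * s) * fderiv ℝ (fderiv ℝ w) (R x₀) (e j) (e j)) =
          fderiv ℝ (fderiv ℝ w) (R x₀) (e j) (e j) := by
        linear_combination (4 * fderiv ℝ (fderiv ℝ w) (R x₀) (e j) (e j)) * hss
      rw [hs2] at key
      simp only [c]
      rw [← hs]
      linear_combination key - 3 * A * hss
    have hsum : ∑ j, c j = (lap w x₀ - lap w (R x₀)) / 2 + 3 * A - 2 * N * δ := by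
      simp only [c, Finset.sum_sub_distrib, Finset.sum_add_distrib, ← Finset.sum_div,
        ← Finset.mul_sum, lap_eq_sum_fderiv, e]
      simp
      ring
    have hle : ∑ j, c j ≤ 0 := Finset.sum_nonpos fun j _ => hc j
    have hl1 := abs_le.1 (hlap x₀)
    have hl2 := abs_le.1 (hlap (R x₀))
    rw [hsum] at hle
    linarith
  have hFt : F (t • e i) ≤ 0 := (hx₀ htS).trans hx₀le
  have hRt : R (t • e i) = -(t • e i) := by
    have : (t • e i) i = t := by simp [heii]
    simp only [R, this]
    module
  have hnt : ‖t • e i‖ = t := by rw [norm_smul, hei, Real.norm_eq_abs, abs_of_pos ht, mul_one]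
  have hit : (t • e i) i = t := by simp [heii]
  simp only [F] at hFt
  rw [hRt, hnt, hit] at hFt
  have h5 : δ * t ^ 2 ≤ A / 2 * (t * d) := by
    have : t ^ 2 ≤ t * d := by nlinarith
    exact mul_le_mul hδA this (by positivity) (by positivity)
  have h6 : 3 * A / 2 * (t * (d - t)) ≤ 3 * A / 2 * (t * d) := by
    have : 0 < t * t := mul_pos ht ht
    exact mul_le_mul_of_nonneg_left (by nlinarith) (by positivity)
  change (w (t • e i) - w (-(t • e i))) / 2 ≤ _
  linarith

theorem lap_comp_add_right {N : ℕ} (u : EuclideanSpace ℝ (Fin N) → ℝ)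
    (h x : EuclideanSpace ℝ (Fin N)) : lap (fun y => u (y + h)) x = lap u (x + h) := by
  have h1 : fderiv ℝ (fun y => u (y + h)) = fun y => fderiv ℝ u (y + h) :=
    funext fun y => fderiv_comp_add_right h
  simp only [lap_eq_sum_fderiv, h1, fderiv_comp_add_right]

theorem fderiv_translate_sub {E F : Type*} [NormedAddCommGroup E] [NormedSpace ℝ E]
    [NormedAddCommGroup F] [NormedSpace ℝ F] {u : E → F} (hu : Differentiable ℝ u) (h x : E) :
    fderiv ℝ (fun y => u (y + h) - u y) x = fderiv ℝ u (x + h) - fderiv ℝ u x := by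
  rw [fderiv_fun_sub ((differentiableAt_comp_add_right h).2 (hu _)) (hu x), fderiv_comp_add_right]

theorem lap_translate_sub {N : ℕ} {u : EuclideanSpace ℝ (Fin N) → ℝ} (hu : ContDiff ℝ 2 u)
    (h x : EuclideanSpace ℝ (Fin N)) :
    lap (fun y => u (y + h) - u y) x = lap u (x + h) - lap u x := by
  have h1 : fderiv ℝ (fun y => u (y + h) - u y) = fun y => fderiv ℝ u (y + h) - fderiv ℝ u y :=
    funext fun y => fderiv_translate_sub (hu.differentiable (by norm_num)) h y
  simp only [lap_eq_sum_fderiv, h1, fderiv_translate_sub hu.differentiable_fderiv_of_two]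
  simp

theorem lap_fun_neg {N : ℕ} (u : EuclideanSpace ℝ (Fin N) → ℝ) (x : EuclideanSpace ℝ (Fin N)) :
    lap (fun y => -u y) x = -lap u x := by
  have h1 : fderiv ℝ (fun y => -u y) = fun y => -fderiv ℝ u y := funext fun y => fderiv_fun_neg
  simp only [lap_eq_sum_fderiv, h1, fderiv_fun_neg, neg_apply, Finset.sum_neg_distrib]

theorem norm_le_of_coord_le {N : ℕ} {L : EuclideanSpace ℝ (Fin N) →L[ℝ] ℝ} {C : ℝ} (hC : 0 ≤ C)
    (h : ∀ i, |L (EuclideanSpace.single i 1)| ≤ C) : ‖L‖ ≤ N * C := by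
  refine L.opNorm_le_bound (by positivity) fun x => ?_
  have hx : x = ∑ i, x i • EuclideanSpace.single i (1 : ℝ) := by
    simpa using ((EuclideanSpace.basisFun (Fin N) ℝ).sum_repr x).symm
  calc ‖L x‖ = ‖∑ i, x i * L (EuclideanSpace.single i 1)‖ := by
        conv_lhs => rw [hx]
        simp
    _ ≤ ∑ i : Fin N, ‖x‖ * C := by
        refine norm_sum_le_of_le _ fun i _ => ?_
        rw [norm_mul]
        exact mul_le_mul (PiLp.norm_apply_le x i) (h i) (norm_nonneg _) (norm_nonneg _)
    _ = N * C * ‖x‖ := by simp; ring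

/-- Interior gradient estimate for bounded functions with bounded Laplacian. -/
theorem norm_fderiv_le_of_lap {N : ℕ} {w : EuclideanSpace ℝ (Fin N) → ℝ}
    (hw : ContDiff ℝ 2 w) {M A d : ℝ} (hA : 0 < A) (hd : 0 < d) (hM : ∀ x, |w x| ≤ M)
    (hlap : ∀ x, |lap w x| ≤ A) (x : EuclideanSpace ℝ (Fin N)) :
    ‖fderiv ℝ w x‖ ≤ N * (M / d + 2 * A * d) := by
  have hM0 : 0 ≤ M := (abs_nonneg _).trans (hM 0)
  have hK : 0 ≤ M / d + 2 * A * d := by positivity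
  have one_side : ∀ {v : EuclideanSpace ℝ (Fin N) → ℝ}, ContDiff ℝ 2 v → (∀ x, |v x| ≤ M) →
      (∀ x, |lap v x| ≤ A) → ∀ i,
      fderiv ℝ v 0 (EuclideanSpace.single i 1) ≤ M / d + 2 * A * d := by
    intro v hv hMv hlv i
    have hdiff : Differentiable ℝ v := hv.differentiable (by norm_num)
    have h1 := hasDerivAt_comp_line hdiff 0 (EuclideanSpace.single i 1) 0
    have h2 := hasDerivAt_comp_line hdiff 0 (-EuclideanSpace.single i 1) 0
    have h3 := ((h1.sub h2).div_const 2).tendsto_slope_zero_right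
    simp only [zero_smul, add_zero, zero_add, map_neg, sub_neg_eq_add, smul_neg, smul_eq_mul,
      neg_zero, add_self_div_two, Pi.sub_apply, sub_self, zero_div, sub_zero] at h3
    refine le_of_tendsto h3 ?_
    filter_upwards [Ioo_mem_nhdsGT hd] with t ht
    have := odd_part_le_barrier i hv hA hMv hlv ht.1 ht.2
    rw [inv_mul_le_iff₀ ht.1]
    simpa using this
  refine norm_le_of_coord_le hK fun i => ?_
  have hwx : ContDiff ℝ 2 fun y => w (y + x) := hw.comp (contDiff_id.add contDiff_const)
  have hpos := one_side hwx (fun y => hM _) (fun y => by rw [lap_comp_add_right]; exact hlap _) i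
  have hneg := one_side (v := fun y => -w (y + x)) hwx.neg (fun y => by rw [abs_neg]; exact hM _)
    (fun y => by rw [lap_fun_neg, abs_neg, lap_comp_add_right]; exact hlap _) i
  rw [fderiv_fun_neg] at hneg
  rw [fderiv_comp_add_right, zero_add] at hpos hneg
  exact abs_le.2 ⟨by simp at hneg ⊢; linarith, hpos⟩

theorem norm_translate_sub_le {E F : Type*} [NormedAddCommGroup E] [NormedSpace ℝ E]
    [NormedAddCommGroup F] [NormedSpace ℝ F] {w : E → F} (hw : Differentiable ℝ w) {C : ℝ}
    (hC : ∀ x, ‖fderiv ℝ w x‖ ≤ C) (x h : E) : ‖w (x + h) - w x‖ ≤ C * ‖h‖ := by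
  simpa using convex_univ.norm_image_sub_le_of_norm_fderiv_le (𝕜 := ℝ) (fun y _ => hw y)
    (fun y _ => hC y) (Set.mem_univ x) (Set.mem_univ (x + h))

/-- Bounded functions with bounded Lipschitz Laplacian have bounded first and second derivatives,
and their second derivative is Hölder continuous of exponent `1/2`. -/
theorem exists_bounds_of_lap {N : ℕ} {u : EuclideanSpace ℝ (Fin N) → ℝ} (hu : ContDiff ℝ 2 u)
    {M A L : ℝ} (hA : 0 < A) (hL : 0 < L) (hM : ∀ x, |u x| ≤ M) (hlap : ∀ x, |lap u x| ≤ A)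
    (hlip : ∀ x y, |lap u x - lap u y| ≤ L * |u x - u y|) :
    ∃ C, (∀ x, ‖fderiv ℝ u x‖ ≤ C) ∧ (∀ x, ‖fderiv ℝ (fderiv ℝ u) x‖ ≤ C) ∧
      ∀ x k, ‖fderiv ℝ (fderiv ℝ u) (x + k) - fderiv ℝ (fderiv ℝ u) x‖ ≤ C * √‖k‖ := by
  have hM0 : 0 ≤ M := (abs_nonneg _).trans (hM 0)
  have hdiff : Differentiable ℝ u := hu.differentiable (by norm_num)
  have hdiff2 := hu.differentiable_fderiv_of_two
  obtain ⟨C₁, hC₁0, hC₁⟩ : ∃ C, 0 < C ∧ ∀ x, ‖fderiv ℝ u x‖ ≤ C :=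
    ⟨N * (M / 1 + 2 * A * 1) + 1, by positivity, fun x =>
      (norm_fderiv_le_of_lap hu hA one_pos hM hlap x).trans (by linarith)⟩
  have hsub : ∀ h, ContDiff ℝ 2 fun y => u (y + h) - u y := fun h =>
    (hu.comp (contDiff_id.add contDiff_const)).sub hu
  have hlapsub : ∀ h x, |lap (fun y => u (y + h) - u y) x| ≤ L * C₁ * ‖h‖ := fun h x => by
    rw [lap_translate_sub hu, mul_assoc]
    exact (hlip _ _).trans (mul_le_mul_of_nonneg_left (norm_translate_sub_le hdiff hC₁ x h) hL.le)
  obtain ⟨C₂, hC₂0, hC₂⟩ : ∃ C, 0 ≤ C ∧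
      ∀ h x, ‖fderiv ℝ u (x + h) - fderiv ℝ u x‖ ≤ C * ‖h‖ := by
    refine ⟨N * (C₁ + 2 * L * C₁), by positivity, fun h x => ?_⟩
    rcases eq_or_ne h 0 with rfl | hh
    · simp
    have hh' : 0 < ‖h‖ := norm_pos_iff.2 hh
    have := norm_fderiv_le_of_lap (hsub h) (by positivity) one_pos
      (fun x => norm_translate_sub_le hdiff hC₁ x h) (hlapsub h) x
    rw [fderiv_translate_sub hdiff] at this
    exact this.trans_eq (by ring)
  have hsub2 : ∀ h k, ContDiff ℝ 2 fun y => (u (y + k + h) - u (y + k)) - (u (y + h) - u y) :=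
    fun h k => ((hsub h).comp (contDiff_id.add contDiff_const)).sub (hsub h)
  obtain ⟨C₃, hC₃0, hC₃⟩ : ∃ C, 0 ≤ C ∧ ∀ h k x,
      ‖(fderiv ℝ u (x + k + h) - fderiv ℝ u (x + k)) - (fderiv ℝ u (x + h) - fderiv ℝ u x)‖
        ≤ C * √‖k‖ * ‖h‖ := by
    refine ⟨N * (C₂ + 4 * L * C₁), by positivity, fun h k x => ?_⟩
    rcases eq_or_ne h 0 with rfl | hh
    · simp
    rcases eq_or_ne k 0 with rfl | hk
    · simp
    have hh' : 0 < ‖h‖ := norm_pos_iff.2 hh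
    have hk' : 0 < √‖k‖ := Real.sqrt_pos.2 (norm_pos_iff.2 hk)
    have hbd : ∀ x, |(u (x + k + h) - u (x + k)) - (u (x + h) - u x)| ≤ C₂ * ‖h‖ * ‖k‖ := fun x =>
      norm_translate_sub_le ((hsub h).differentiable (by norm_num)) (C := C₂ * ‖h‖)
        (fun y => by rw [fderiv_translate_sub hdiff]; exact hC₂ h y) x k
    have hlap2 : ∀ x, |lap (fun y => (u (y + k + h) - u (y + k)) - (u (y + h) - u y)) x|
        ≤ 2 * (L * C₁ * ‖h‖) := fun x => by
      rw [lap_translate_sub (hsub h) k x]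
      exact (abs_sub _ _).trans (by linarith [hlapsub h x, hlapsub h (x + k)])
    have := norm_fderiv_le_of_lap (hsub2 h k) (by positivity) hk' hbd hlap2 x
    rw [fderiv_translate_sub ((hsub h).differentiable (by norm_num)) k x,
      fderiv_translate_sub hdiff, fderiv_translate_sub hdiff] at this
    refine this.trans_eq ?_
    rw [mul_div_assoc, Real.div_sqrt]
    ring
  refine ⟨C₁ + C₂ + C₃, fun x => (hC₁ x).trans (by linarith), fun x => ?_, fun x k => ?_⟩
  · refine le_trans ((hdiff2 x).hasFDerivAt.le_of_lip' hC₂0 ?_) (by linarith : C₂ ≤ _)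
    refine Eventually.of_forall fun y => ?_
    simpa using hC₂ (y - x) x
  · refine le_trans ?_ (mul_le_mul_of_nonneg_right (by linarith : C₃ ≤ _) (Real.sqrt_nonneg _))
    rw [← fderiv_translate_sub hdiff2]
    have hd : Differentiable ℝ fun y => fderiv ℝ u (y + k) - fderiv ℝ u y :=
      (hdiff2.comp (differentiable_id.add_const k)).sub hdiff2
    refine (hd x).hasFDerivAt.le_of_lip' (by positivity) (Eventually.of_forall fun y => ?_)
    have := hC₃ (y - x) k x
    rw [show x + k + (y - x) = y + k by abel, show x + (y - x) = y by abel] at this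
    refine le_of_eq_of_le ?_ this
    congr 1
    abel

/-- Pointwise limits of translates of a function whose derivative has a uniform modulus of
continuity are differentiable, with the expected derivative. -/
theorem hasFDerivAt_of_tendsto_translates {E G : Type*} [NormedAddCommGroup E] [NormedSpace ℝ E]
    [NormedAddCommGroup G] [NormedSpace ℝ G] {l : Filter E} [l.NeBot] {w V : E → G}
    {P : E → E →L[ℝ] G} (hw : Differentiable ℝ w) {ω : ℝ → ℝ} (hωmono : Monotone ω)
    (hω : Tendsto ω (𝓝 0) (𝓝 0)) (hmod : ∀ x k, ‖fderiv ℝ w (x + k) - fderiv ℝ w x‖ ≤ ω ‖k‖)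
    (hV : ∀ x, Tendsto (fun y => w (y + x)) l (𝓝 (V x)))
    (hP : ∀ x, Tendsto (fun y => fderiv ℝ w (y + x)) l (𝓝 (P x))) (x : E) :
    HasFDerivAt V (P x) x := by
  have taylor : ∀ x h, ‖w (x + h) - w x - fderiv ℝ w x h‖ ≤ ω ‖h‖ * ‖h‖ := by
    intro x h
    have := (convex_closedBall x ‖h‖).norm_image_sub_le_of_norm_fderiv_le' (𝕜 := ℝ) (f := w)
      (φ := fderiv ℝ w x) (C := ω ‖h‖) (x := x) (y := x + h) (fun y _ => hw y)
      (fun y hy => by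
        have h1 := hmod x (y - x)
        rw [add_sub_cancel] at h1
        exact h1.trans (hωmono (by simpa [dist_eq_norm] using hy)))
      (by simp) (by simp)
    simpa using this
  have limit : ∀ h, ‖V (x + h) - V x - P x h‖ ≤ ω ‖h‖ * ‖h‖ := by
    intro h
    refine le_of_tendsto (((hV (x + h)).sub (hV x)).sub (((ContinuousLinearMap.apply ℝ G h).continuous.tendsto
      _).comp (hP x))).norm (Eventually.of_forall fun y => ?_)
    have := taylor (y + x) h
    rwa [add_assoc] at this
  rw [hasFDerivAt_iff_isLittleO_nhds_zero]
  refine Asymptotics.IsLittleO.of_bound fun c hc => ?_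
  have h0 : Tendsto (fun h : E => ω ‖h‖) (𝓝 0) (𝓝 0) := hω.comp tendsto_norm_zero
  filter_upwards [h0.eventually (gt_mem_nhds hc)] with h hh
  exact (limit h).trans (mul_le_mul_of_nonneg_right hh.le (norm_nonneg _))

theorem exists_ultrafilter_lim {α G : Type*} [NormedAddCommGroup G] [ProperSpace G]
    (l : Ultrafilter α) {w : α → G} {C : ℝ} (hC : ∀ x, ‖w x‖ ≤ C) :
    ∃ a, ‖a‖ ≤ C ∧ Tendsto w l (𝓝 a) := by
  obtain ⟨a, ha, hla⟩ := (isCompact_closedBall (0 : G) C).ultrafilter_le_nhds (l.map w)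
    (by
      rw [Ultrafilter.coe_map, le_principal_iff, mem_map]
      exact univ_mem' fun x => by simpa using hC x)
  exact ⟨a, by simpa using ha, hla⟩

theorem continuous_of_tendsto_translates {E G : Type*} [NormedAddCommGroup E]
    [NormedAddCommGroup G] {l : Filter E} [l.NeBot] {w V : E → G} {ω : ℝ → ℝ}
    (hω : Tendsto ω (𝓝 0) (𝓝 0)) (hmod : ∀ x k, ‖w (x + k) - w x‖ ≤ ω ‖k‖)
    (hV : ∀ x, Tendsto (fun y => w (y + x)) l (𝓝 (V x))) : Continuous V := by
  refine continuous_iff_continuousAt.2 fun x => ?_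
  have h0 : Tendsto (fun z : E => ω ‖z - x‖) (𝓝 x) (𝓝 0) := by
    refine hω.comp ?_
    have : ContinuousAt (fun z : E => ‖z - x‖) x := by fun_prop
    simpa [ContinuousAt] using this
  refine tendsto_iff_norm_sub_tendsto_zero.2 (squeeze_zero (fun _ => norm_nonneg _)
    (fun z => ?_) h0)
  refine le_of_tendsto ((hV z).sub (hV x)).norm (Eventually.of_forall fun y => ?_)
  have := hmod (y + x) (z - x)
  rwa [add_assoc, add_sub_cancel] at this

/-- Pointwise convergence of translates of a uniformly continuous function is uniform on compact
sets. -/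
theorem eventually_translates_close {E : Type*} [NormedAddCommGroup E] {l : Filter E}
    {g V : E → ℝ} (hg : UniformContinuous g) (hVc : Continuous V)
    (hV : ∀ x, Tendsto (fun y => g (y + x)) l (𝓝 (V x))) {S : Set E} (hS : IsCompact S) {ε : ℝ}
    (hε : 0 < ε) : ∀ᶠ y in l, ∀ x ∈ S, |g (y + x) - V x| < ε := by
  obtain ⟨δ, hδ, hgδ⟩ := Metric.uniformContinuous_iff.1 hg (ε / 3) (by positivity)
  have hloc : ∀ x ∈ S, ∃ t ∈ 𝓝[S] x, ∀ᶠ y in l, ∀ z ∈ t, |g (y + z) - V z| < ε := by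
    intro x _
    refine ⟨{z | dist z x < δ ∧ |V z - V x| < ε / 3}, mem_nhdsWithin_of_mem_nhds
      (inter_mem (Metric.ball_mem_nhds x hδ)
        (hVc.continuousAt.eventually (Metric.ball_mem_nhds (V x) (by positivity)))), ?_⟩
    filter_upwards [(hV x).eventually (Metric.ball_mem_nhds (V x) (by positivity : 0 < ε / 3))]
      with y hy z hz
    have h1 : |g (y + z) - g (y + x)| < ε / 3 := hgδ (by simpa using hz.1)
    have h2 : |g (y + x) - V x| < ε / 3 := hy
    have h3 := hz.2
    rw [abs_lt] at *
    constructor <;> linarith [h1.1, h1.2, h2.1, h2.2, h3.1, h3.2]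
  exact hS.induction_on (p := fun t => ∀ᶠ y in l, ∀ z ∈ t, |g (y + z) - V z| < ε) (by simp)
    (fun s t hst ht => ht.mono fun y hy z hz => hy z (hst hz))
    (fun s t hs ht => by
      filter_upwards [hs, ht] with y h1 h2 z hz using hz.elim (h1 z) (h2 z)) hloc

open scoped Pointwise in
/-- Stability outside a compact set becomes stability for limits of translates at infinity. -/
theorem StableOutside.stable_of_tendsto_translates {N : ℕ} {g : ℝ → ℝ}
    {u v : EuclideanSpace ℝ (Fin N) → ℝ} {K : Set (EuclideanSpace ℝ (Fin N))}
    (hstab : StableOutside g u K) (hK : IsCompact K)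
    {l : Filter (EuclideanSpace ℝ (Fin N))} [l.NeBot] (hl : l ≤ cocompact _)
    (hg : Continuous g) (hgu : UniformContinuous fun x => g (u x)) (hvc : Continuous v)
    (hv : ∀ x, Tendsto (fun y => u (y + x)) l (𝓝 (v x))) : Stable g v := by
  intro φ hφ hφc
  have hφ2c : HasCompactSupport fun x => φ x ^ 2 :=
    hφc.comp_left (g := fun t : ℝ => t ^ 2) (by simp)
  have hφ2 : Continuous fun x => φ x ^ 2 := hφ.continuous.pow 2
  have hint : Integrable fun x => φ x ^ 2 := hφ2.integrable_of_hasCompactSupport hφ2c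
  have hgv : Integrable fun x => g (v x) * φ x ^ 2 :=
    ((hg.comp hvc).mul hφ2).integrable_of_hasCompactSupport hφ2c.mul_left
  have hI : 0 ≤ ∫ x, φ x ^ 2 := integral_nonneg fun x => sq_nonneg _
  have main : ∀ ε > 0, ∫ x, g (v x) * φ x ^ 2 ≤ (∫ x, ‖gradient φ x‖ ^ 2) + ε * ∫ x, φ x ^ 2 := by
    intro ε hε
    have h1 := eventually_translates_close (l := l) hgu (hg.comp hvc)
      (fun x => (hg.tendsto _).comp (hv x)) hφc.isCompact hε
    have h2 : ∀ᶠ y in l, y ∉ K - tsupport φ :=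
      by
      rw [sub_eq_add_neg]
      exact hl (hK.add hφc.isCompact.neg).compl_mem_cocompact
    obtain ⟨y, hy1, hy2⟩ := (h1.and h2).exists
    have hsupp : tsupport (fun x => φ (x - y)) ⊆ Kᶜ := by
      intro x hx hxK
      have h3 : x - y ∈ tsupport φ := by
        have := tsupport_comp_subset_preimage φ (f := fun x => x - y) (by fun_prop) hx
        exact this
      exact hy2 ⟨x, hxK, x - y, h3, by simp⟩
    have h4 := hstab (fun x => φ (x - y)) (hφ.comp (contDiff_id.sub contDiff_const))
      (hφc.comp_homeomorph (Homeomorph.subRight y)) hsupp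
    have hgrad : ∀ x, gradient (fun x => φ (x - y)) x = gradient φ (x - y) := fun x => by
      simp only [gradient, sub_eq_add_neg, fderiv_comp_add_right]
    simp only [hgrad] at h4
    rw [integral_sub_right_eq_self (fun x => ‖gradient φ x‖ ^ 2) y] at h4
    have h5 : ∫ x, g (u x) * φ (x - y) ^ 2 = ∫ x, g (u (y + x)) * φ x ^ 2 := by
      rw [← integral_add_left_eq_self _ y]
      simp
    rw [h5] at h4
    have hgui : Integrable fun x => g (u (y + x)) * φ x ^ 2 :=
      ((hgu.continuous.comp (continuous_const.add continuous_id)).mul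
        hφ2).integrable_of_hasCompactSupport hφ2c.mul_left
    calc ∫ x, g (v x) * φ x ^ 2 ≤ ∫ x, g (u (y + x)) * φ x ^ 2 + ε * φ x ^ 2 := by
          refine integral_mono hgv (hgui.add (hint.const_mul ε)) fun x => ?_
          by_cases hx : x ∈ tsupport φ
          · have := (abs_lt.1 (hy1 x hx)).1
            simp only [Function.comp_apply] at this
            nlinarith [sq_nonneg (φ x)]
          · simp [image_eq_zero_of_notMem_tsupport hx]
      _ = (∫ x, g (u (y + x)) * φ x ^ 2) + ε * ∫ x, φ x ^ 2 := by
          rw [integral_add hgui (hint.const_mul ε), integral_const_mul]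
      _ ≤ _ := by linarith
  refine le_of_forall_pos_le_add fun η hη => ?_
  refine (main (η / ((∫ x, φ x ^ 2) + 1)) (by positivity)).trans ?_
  have : η / ((∫ x, φ x ^ 2) + 1) * (∫ x, φ x ^ 2) ≤ η := by
    rw [div_mul_eq_mul_div, div_le_iff₀ (by positivity)]
    nlinarith
  linarith

/-- Proposition 1.12: if `u = 0` is the only bounded stable `C²` solution of
`−Δu = f(u)` in `ℝ^N`, then every bounded solution which is stable outside a compact set
tends to `0` at infinity. -/
theorem stmt7 {N : ℕ} (hN : 1 ≤ N) (f : ℝ → ℝ) (hf : ContDiff ℝ 1 f)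
    (huniq : ∀ v : EuclideanSpace ℝ (Fin N) → ℝ, ContDiff ℝ 2 v →
      (∃ M, ∀ x, |v x| ≤ M) → (∀ x, -lap v x = f (v x)) → Stable (deriv f) v →
      ∀ x, v x = 0)
    (u : EuclideanSpace ℝ (Fin N) → ℝ) (hu : ContDiff ℝ 2 u)
    (hbd : ∃ M, ∀ x, |u x| ≤ M)
    (hsol : ∀ x, -lap u x = f (u x))
    (hstab : ∃ K : Set (EuclideanSpace ℝ (Fin N)), IsCompact K ∧
      StableOutside (deriv f) u K) :
    Tendsto u (Filter.cocompact (EuclideanSpace ℝ (Fin N))) (𝓝 0) := by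

  obtain ⟨M, hM⟩ := hbd
  obtain ⟨K, hK, hst⟩ := hstab
  have hf' : Continuous (deriv f) := hf.continuous_deriv (by norm_num)
  have huI : ∀ x, u x ∈ Set.Icc (-M) M := fun x => abs_le.1 (hM x)
  obtain ⟨A, hA⟩ := (isCompact_Icc (a := -M) (b := M)).exists_bound_of_continuousOn
    hf.continuous.continuousOn
  obtain ⟨L, hL⟩ := (isCompact_Icc (a := -M) (b := M)).exists_bound_of_continuousOn
    hf'.continuousOn
  have hlapu : ∀ x, lap u x = -f (u x) := fun x => by rw [← hsol x, neg_neg]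
  have hfL : ∀ x y, |lap u x - lap u y| ≤ max L 1 * |u x - u y| := fun x y => by
    rw [hlapu, hlapu, neg_sub_neg, abs_sub_comm]
    exact (convex_Icc (-M) M).norm_image_sub_le_of_norm_deriv_le (f := f)
      (fun z _ => hf.differentiable (by norm_num) z)
      (fun z hz => (hL z hz).trans (le_max_left _ _)) (huI y) (huI x)
  obtain ⟨C, hC1, hC2, hC3⟩ := exists_bounds_of_lap hu (A := max A 1) (by positivity)
    (by positivity : 0 < max L 1) hM
    (fun x => by rw [hlapu, abs_neg]; exact (hA _ (huI x)).trans (le_max_left _ _)) hfL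
  have hC0 : 0 ≤ C := (norm_nonneg _).trans (hC1 0)
  have hdiff : Differentiable ℝ u := hu.differentiable (by norm_num)
  have hdiff2 := hu.differentiable_fderiv_of_two
  refine (tendsto_iff_ultrafilter _ _ _).2 fun l hl => ?_
  choose v hvM hv using fun x => exists_ultrafilter_lim l (w := fun y => u (y + x))
    (fun y => hM (y + x))
  choose p _ hp using fun x => exists_ultrafilter_lim l (fun y => hC1 (y + x))
  choose q _ hq using fun x => exists_ultrafilter_lim l
    (w := fun y => fderiv ℝ (fderiv ℝ u) (y + x)) (fun y => hC2 (y + x))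
  have hlin : Tendsto (fun r : ℝ => C * r) (𝓝 0) (𝓝 0) := by
    simpa using (continuous_const_mul C).tendsto 0
  have hsqrt : Tendsto (fun r : ℝ => C * √r) (𝓝 0) (𝓝 0) := by
    simpa using (Real.continuous_sqrt.const_mul C).tendsto 0
  have hvp : ∀ x, HasFDerivAt v (p x) x :=
    hasFDerivAt_of_tendsto_translates hdiff (fun a b h => mul_le_mul_of_nonneg_left h hC0) hlin
      (fun x k => norm_translate_sub_le hdiff2 hC2 x k) hv hp
  have hpq : ∀ x, HasFDerivAt p (q x) x :=
    hasFDerivAt_of_tendsto_translates hdiff2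
      (fun a b h => mul_le_mul_of_nonneg_left (Real.sqrt_le_sqrt h) hC0) hsqrt hC3 hp hq
  have hqc : Continuous q := continuous_of_tendsto_translates hsqrt hC3 hq
  have hv1 : fderiv ℝ v = p := funext fun x => (hvp x).fderiv
  have hp1 : fderiv ℝ p = q := funext fun x => (hpq x).fderiv
  have hvC : ContDiff ℝ 2 v := by
    rw [show (2 : WithTop ℕ∞) = 1 + 1 by norm_num, contDiff_succ_iff_fderiv, hv1,
      contDiff_one_iff_fderiv, hp1]
    exact ⟨fun x => (hvp x).differentiableAt, by simp, fun x => (hpq x).differentiableAt, hqc⟩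
  have hvsol : ∀ x, -lap v x = f (v x) := fun x => by
    have h1 : Tendsto (fun y => -lap u (y + x)) l (𝓝 (-lap v x)) := by
      simp only [lap_eq_sum_fderiv, hv1, hp1]
      exact (tendsto_finsetSum _ fun i _ => ((((ContinuousLinearMap.apply ℝ ℝ _).comp
        (ContinuousLinearMap.apply ℝ _ _)).continuous.tendsto _).comp (hq x))).neg
    simp only [hsol] at h1
    exact tendsto_nhds_unique h1 ((hf.continuous.tendsto _).comp (hv x))
  have hguc : UniformContinuous fun x => deriv f (u x) := by
    have hlip : LipschitzWith ⟨C, hC0⟩ u := lipschitzWith_of_nnnorm_fderiv_le hdiff hC1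
    have h1 := (isCompact_Icc (a := -M) (b := M)).uniformContinuousOn_of_continuous hf'.continuousOn
    rw [← uniformContinuousOn_univ]
    exact h1.comp hlip.uniformContinuous.uniformContinuousOn fun x _ => huI x
  have hvs : Stable (deriv f) v :=
    hst.stable_of_tendsto_translates hK hl hf' hguc hvC.continuous hv
  have hv0 := hv 0
  rw [huniq v hvC ⟨M, hvM⟩ hvsol hvs 0] at hv0
  simpa using hv0
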